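/- Let G be a group, and let A and B be minimal G-trees whose translation length functions ℓ = ℓ_A and m = ℓ_B are axiomatic length functions that have compatible combinatorics and are coherently oriented. Let T be a minimal G-tree whose translation length function satisfies ℓ_T = ℓ + m. Then there exist points p ∈ A, q ∈ B and r ∈ T such that for all g ∈ G, d_T(r, r·g) = d_A(p, p·g) + d_B(q, q·g); that is, the based length function of (T, r) is the sum of the based length functions of (A, p) and (B, q). -/

import Mathlib

/-- A real tree: a nonempty complete geodesic 0-hyperbolic metric space. -/
def IsRealTree (T : Type*) [MetricSpace T] : Prop :=
  Nonempty T ∧ CompleteSpace T ∧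
  (∀ x y : T, ∃ f : ℝ → T, f 0 = x ∧ f (dist x y) = y ∧
    ∀ s ∈ Set.Icc (0 : ℝ) (dist x y), ∀ t ∈ Set.Icc (0 : ℝ) (dist x y),
      dist (f s) (f t) = |s - t|) ∧
  (∀ x y z w : T, dist x y + dist z w ≤
    max (dist x z + dist y w) (dist x w + dist y z))

/-- `σ : T → G → T` is a right action of `G` on `T` by isometries. -/
def IsIsomRightAction {G : Type*} [Group G] {T : Type*} [MetricSpace T]
    (σ : T → G → T) : Prop :=
  (∀ p : T, σ p 1 = p) ∧
  (∀ (p : T) (g h : G), σ p (g * h) = σ (σ p g) h) ∧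
  (∀ g : G, Isometry (fun p : T => σ p g))

/-- The translation length function of the action `σ`: `ℓ(g) = inf_p d(p, p·g)`. -/
noncomputable def transLen {G : Type*} [Group G] {T : Type*} [MetricSpace T]
    (σ : T → G → T) (g : G) : ℝ :=
  ⨅ p : T, dist p (σ p g)

/-- The characteristic set `C_g = {p : d(p, p·g) = ℓ(g)}` of `g`. -/
def charSet {G : Type*} [Group G] {T : Type*} [MetricSpace T]
    (σ : T → G → T) (g : G) : Set T :=
  {p : T | dist p (σ p g) = transLen σ g}

/-- The segment `[p,q] = {z : d(p,z) + d(z,q) = d(p,q)}`. -/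
def treeSegment {T : Type*} [MetricSpace T] (p q : T) : Set T :=
  {z : T | dist p z + dist z q = dist p q}

/-- `(x,y)` is a good pair for `ℓ` if `0 < ℓ(x)+ℓ(y)−ℓ(xy⁻¹) < 2·min{ℓ(x),ℓ(y)}`. -/
def GoodPair {G : Type*} [Group G] (ℓ : G → ℝ) (g h : G) : Prop :=
  0 < ℓ g + ℓ h - ℓ (g * h⁻¹) ∧
  ℓ g + ℓ h - ℓ (g * h⁻¹) < 2 * min (ℓ g) (ℓ h)

/-- The overlap set `O^ℓ`: pairs of distinct elements with `ℓ(gh) ≠ ℓ(gh⁻¹)`. -/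
def OverlapSet {G : Type*} [Group G] (ℓ : G → ℝ) : Set (G × G) :=
  {p : G × G | p.1 ≠ p.2 ∧ ℓ (p.1 * p.2) ≠ ℓ (p.1 * p.2⁻¹)}

/-- The disjoint set `D^ℓ`: pairs of distinct elements with
`ℓ(gh) = ℓ(gh⁻¹) > ℓ(g) + ℓ(h)`. -/
def DisjointSet {G : Type*} [Group G] (ℓ : G → ℝ) : Set (G × G) :=
  {p : G × G | p.1 ≠ p.2 ∧ ℓ (p.1 * p.2) = ℓ (p.1 * p.2⁻¹) ∧
    ℓ p.1 + ℓ p.2 < ℓ (p.1 * p.2)}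

/-- `ℓ` and `m` have compatible combinatorics if `O^ℓ ∩ D^m = ∅ = D^ℓ ∩ O^m`. -/
def CompatibleCombinatorics {G : Type*} [Group G] (ℓ m : G → ℝ) : Prop :=
  OverlapSet ℓ ∩ DisjointSet m = ∅ ∧ DisjointSet ℓ ∩ OverlapSet m = ∅

/-- `ℓ` and `m` are coherently oriented if on `O^ℓ ∩ O^m` the strict inequalities
`ℓ(gh⁻¹) < ℓ(gh)` and `m(gh⁻¹) < m(gh)` are equivalent. -/
def CoherentlyOriented {G : Type*} [Group G] (ℓ m : G → ℝ) : Prop :=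
  ∀ p ∈ OverlapSet ℓ ∩ OverlapSet m,
    (ℓ (p.1 * p.2⁻¹) < ℓ (p.1 * p.2) ↔ m (p.1 * p.2⁻¹) < m (p.1 * p.2))

/-- An axiomatic length function on a group `G` (Culler–Morgan / Parry axioms I–VI). -/
def IsLengthFunction {G : Type*} [Group G] (ℓ : G → ℝ) : Prop :=
  (∀ g : G, 0 ≤ ℓ g) ∧
  ℓ 1 = 0 ∧
  (∀ g : G, ℓ g = ℓ g⁻¹) ∧
  (∀ g h : G, ℓ (h * g * h⁻¹) = ℓ g) ∧
  (∀ g h : G, ℓ (g * h) = ℓ (g * h⁻¹) ∨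
    max (ℓ (g * h)) (ℓ (g * h⁻¹)) ≤ ℓ g + ℓ h) ∧
  (∀ g h : G, 0 < ℓ g → 0 < ℓ h →
    (ℓ (g * h) = ℓ (g * h⁻¹) ∧ ℓ g + ℓ h < ℓ (g * h)) ∨
    max (ℓ (g * h)) (ℓ (g * h⁻¹)) = ℓ g + ℓ h) ∧
  (∃ g h : G, 0 < ℓ g + ℓ h - ℓ (g * h⁻¹) ∧
    ℓ g + ℓ h - ℓ (g * h⁻¹) < 2 * min (ℓ g) (ℓ h))

/-- The action `σ` is minimal: the only nonempty closed connected invariant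
subset is the whole tree. -/
def IsMinimalAction {G : Type*} [Group G] {T : Type*} [MetricSpace T]
    (σ : T → G → T) : Prop :=
  ∀ S : Set T, S.Nonempty → IsClosed S → IsConnected S →
    (∀ p ∈ S, ∀ g : G, σ p g ∈ S) → S = Set.univ

/-! ### Abstract based length functions -/

/-- Twice the Gromov product of `x` and `y`. -/
def gp2 {G : Type*} [Group G] (L : G → ℝ) (x y : G) : ℝ := L x + L y - L (x * y⁻¹)

/-- `x` and `y` point in the same direction. -/
def Sim {G : Type*} [Group G] (L : G → ℝ) (x y : G) : Prop := 0 < gp2 L x y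

/-- A based length function `L` together with the translation length function `ℓ`. -/
structure BL {G : Type*} [Group G] (L ℓ : G → ℝ) : Prop where
  one : L 1 = 0
  inv : ∀ x, L x⁻¹ = L x
  tri : ∀ x y, L (x * y) ≤ L x + L y
  hyp : ∀ x y z, min (gp2 L x y) (gp2 L y z) ≤ gp2 L x z
  le : ∀ x, ℓ x ≤ L x
  eq : ∀ x, ¬ Sim L x x⁻¹ → ℓ x = L x

/-- `x` starts in direction `b` and `x⁻¹` starts in direction `a`. -/
def Dir {G : Type*} [Group G] (L : G → ℝ) (x a b : G) : Prop := Sim L x⁻¹ a ∧ Sim L x b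

namespace BL

variable {G : Type*} [Group G] {L ℓ : G → ℝ}

theorem nonneg (h : BL L ℓ) (x : G) : 0 ≤ L x := by
  have h1 := h.tri x x⁻¹
  rw [mul_inv_cancel, h.one, h.inv] at h1
  linarith

theorem comm (h : BL L ℓ) (x y : G) : gp2 L x y = gp2 L y x := by
  unfold gp2
  rw [← h.inv (x * y⁻¹)]
  simp [add_comm]

theorem scomm (h : BL L ℓ) {x y : G} (hs : Sim L x y) : Sim L y x := by
  unfold Sim at *
  rwa [h.comm]

theorem gp_nonneg (h : BL L ℓ) (x y : G) : 0 ≤ gp2 L x y := by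
  have := h.tri x y⁻¹
  rw [h.inv] at this
  unfold gp2
  linarith

theorem trans (h : BL L ℓ) {x y z : G} (h1 : Sim L x y) (h2 : Sim L y z) : Sim L x z :=
  lt_of_lt_of_le (lt_min h1 h2) (h.hyp x y z)

theorem pos (h : BL L ℓ) {x y : G} (hs : Sim L x y) : 0 < L x := by
  have h1 := h.tri x⁻¹ (x * y⁻¹)
  rw [inv_mul_cancel_left, h.inv, h.inv] at h1
  unfold Sim gp2 at hs
  linarith

theorem Lmul (h : BL L ℓ) {x y : G} (hs : ¬ Sim L x y⁻¹) : L (x * y) = L x + L y := by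
  have h1 := h.gp_nonneg x y⁻¹
  unfold Sim at hs
  unfold gp2 at *
  rw [inv_inv, h.inv] at *
  linarith

theorem sim_mul (h : BL L ℓ) {x y z : G} (hs : ¬ Sim L x y⁻¹) (hz : Sim L y z) :
    Sim L (x * y) z := by
  refine h.trans ?_ hz
  have := h.Lmul hs
  have h2 := h.pos hz
  unfold Sim gp2
  rw [mul_inv_cancel_right]
  linarith

theorem perp_congr (h : BL L ℓ) {x y a b : G} (hs : ¬ Sim L a b) (h1 : Sim L x a)
    (h2 : Sim L y b) : ¬ Sim L x y := fun h3 =>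
  hs (h.trans (h.trans (h.scomm h1) h3) h2)

theorem dir_mul (h : BL L ℓ) {x y a b a' b' : G} (hx : Dir L x a b) (hy : Dir L y a' b')
    (hs : ¬ Sim L b a') : L (x * y) = L x + L y ∧ Dir L (x * y) a b' := by
  have h0 : ¬ Sim L x y⁻¹ := h.perp_congr hs hx.2 hy.1
  refine ⟨h.Lmul h0, ?_, h.sim_mul h0 hy.2⟩
  rw [mul_inv_rev]
  refine h.sim_mul ?_ hx.1
  rw [inv_inv]
  exact fun h3 => h0 (h.scomm h3)

theorem dir_len (h : BL L ℓ) {x a b : G} (hx : Dir L x a b) (hs : ¬ Sim L b a) :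
    ℓ x = L x := h.eq x (h.perp_congr hs hx.2 hx.1)

theorem dir_inv {x a b : G} (hx : Dir L x a b) : Dir L x⁻¹ b a := by
  refine ⟨?_, hx.1⟩
  rw [inv_inv]
  exact hx.2

end BL

/-- Three distinct directions and elements joining them. -/
structure Tri {G : Type*} [Group G] (L : G → ℝ) (d : Fin 3 → G) (E : Fin 3 → Fin 3 → G) :
    Prop where
  perp : ∀ i j, i ≠ j → ¬ Sim L (d i) (d j)
  dir : ∀ i j, i ≠ j → Dir L (E i j) (d i) (d j)

section tri
variable {G : Type*} [Group G] {L ℓ : G → ℝ} {d : Fin 3 → G} {E : Fin 3 → Fin 3 → G}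

theorem Tri.unique (h : BL L ℓ) (t : Tri L d E) (x : G) (i j : Fin 3) (hi : Sim L x (d i))
    (hj : Sim L x (d j)) : i = j := by
  by_contra hne
  exact t.perp i j hne (h.trans (h.scomm hi) hj)

theorem Tri.Elen (h : BL L ℓ) (t : Tri L d E) (i j : Fin 3) (hij : i ≠ j) :
    ℓ (E i j) = L (E i j) :=
  h.dir_len (t.dir i j hij) (t.perp j i hij.symm)

theorem Tri.kv (h : BL L ℓ) (t : Tri L d E) {k v : G} {i e : Fin 3}
    (hi : ¬ Sim L k (d i)) (hv : Dir L v (d i) (d e)) :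
    L (k * v) = L k + L v ∧ Dir L (k * v) (d i * k⁻¹) (d e) := by
  have h0 : ¬ Sim L k v⁻¹ := fun h3 => hi (h.trans h3 hv.1)
  refine ⟨h.Lmul h0, ?_, h.sim_mul h0 hv.2⟩
  have h1 := h.Lmul h0
  have h2 : L (d i * k⁻¹) = L (d i) + L k := by
    have := h.Lmul (x := d i) (y := k⁻¹) (by
      rw [inv_inv]; exact fun h3 => hi (h.scomm h3))
    rwa [h.inv] at this
  have h3 := hv.1
  have h4 := h.nonneg k
  unfold Sim gp2 at *
  rw [h.inv, h1, h2]
  rw [h.inv] at h3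
  have : (k * v)⁻¹ * (d i * k⁻¹)⁻¹ = v⁻¹ * (d i)⁻¹ := by group
  rw [this]
  linarith

/-- `k` can be inserted between directions. -/
def Ok (L : G → ℝ) (d : Fin 3 → G) (k : G) (i j : Fin 3) : Prop :=
  ¬ Sim L k (d i) ∧ ¬ Sim L (d i * k⁻¹) (d j)

theorem Tri.word (h : BL L ℓ) (t : Tri L d E) {k : G} {i j e1 e2 : Fin 3}
    (ok : Ok L d k i j) (h1 : e1 ≠ j) (h2 : e2 ≠ i) (h12 : e1 ≠ e2) :
    L (E e1 j * (k * E i e2)) = L (E e1 j) + L k + L (E i e2) ∧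
    Dir L (E e1 j * (k * E i e2)) (d e1) (d e2) := by
  obtain ⟨a1, a2⟩ := t.kv h ok.1 (t.dir i e2 h2.symm)
  obtain ⟨b1, b2⟩ := h.dir_mul (t.dir e1 j h1) a2 (fun h3 => ok.2 (h.scomm h3))
  exact ⟨by rw [b1, a1]; ring, b2⟩

theorem Tri.word_len (h : BL L ℓ) (t : Tri L d E) {k : G} {i j e1 e2 : Fin 3}
    (ok : Ok L d k i j) (h1 : e1 ≠ j) (h2 : e2 ≠ i) (h12 : e1 ≠ e2) :
    ℓ (E e1 j * (k * E i e2)) = ℓ (E e1 j) + L k + ℓ (E i e2) := by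
  obtain ⟨a1, a2⟩ := t.word h ok h1 h2 h12
  rw [h.dir_len a2 (t.perp _ _ h12.symm), t.Elen h _ _ h1, t.Elen h _ _ h2.symm, a1]

theorem Tri.word_le (h : BL L ℓ) (t : Tri L d E) (k : G) {i j e1 e2 : Fin 3}
    (h1 : e1 ≠ j) (h2 : e2 ≠ i) :
    ℓ (E e1 j * (k * E i e2)) ≤ ℓ (E e1 j) + L k + ℓ (E i e2) := by
  rw [t.Elen h _ _ h1, t.Elen h _ _ h2.symm]
  have a := h.le (E e1 j * (k * E i e2))
  have b := h.tri (E e1 j) (k * E i e2)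
  have c := h.tri k (E i e2)
  linarith

theorem pigeon3 (P Q : Fin 3 → Prop) (hP : ∀ i j, P i → P j → i = j)
    (hQ : ∀ i j, Q i → Q j → i = j) : ∃ i, ¬ P i ∧ ¬ Q i := by
  by_contra hcon
  push Not at hcon
  have p01 := hP 0 1
  have p02 := hP 0 2
  have p12 := hP 1 2
  have q01 := hQ 0 1
  have q02 := hQ 0 2
  have q12 := hQ 1 2
  have c0 := hcon 0
  have c1 := hcon 1
  have c2 := hcon 2
  have n01 : (0 : Fin 3) ≠ 1 := by decide
  have n02 : (0 : Fin 3) ≠ 2 := by decide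
  have n12 : (1 : Fin 3) ≠ 2 := by decide
  tauto

theorem choose_e (i j : Fin 3) : ∃ e1 e2 : Fin 3, e1 ≠ j ∧ e2 ≠ i ∧ e1 ≠ e2 := by
  revert i j; decide

/-- The key comparison. -/
theorem based_sum {LA LB LT lA lB lT : G → ℝ} (hA : BL LA lA) (hB : BL LB lB) (hT : BL LT lT)
    (tA : Tri LA d E) (tB : Tri LB d E) (tT : Tri LT d E)
    (hs : ∀ g, lT g = lA g + lB g) (k : G) : LT k = LA k + LB k := by
  apply le_antisymm
  · obtain ⟨i, hi, -⟩ := pigeon3 (fun i => Sim LT k (d i)) (fun i => Sim LT k (d i))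
      (tT.unique hT k) (tT.unique hT k)
    obtain ⟨j, hj, -⟩ := pigeon3 (fun j => Sim LT (d i * k⁻¹) (d j))
      (fun j => Sim LT (d i * k⁻¹) (d j)) (tT.unique hT _) (tT.unique hT _)
    obtain ⟨e1, e2, h1, h2, h12⟩ := choose_e i j
    have a := tT.word_len hT ⟨hi, hj⟩ h1 h2 h12
    have b := tA.word_le hA k h1 h2
    have c := tB.word_le hB k h1 h2
    simp only [hs] at a
    linarith
  · obtain ⟨i, hi, hi'⟩ := pigeon3 (fun i => Sim LA k (d i)) (fun i => Sim LB k (d i))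
      (tA.unique hA k) (tB.unique hB k)
    obtain ⟨j, hj, hj'⟩ := pigeon3 (fun j => Sim LA (d i * k⁻¹) (d j))
      (fun j => Sim LB (d i * k⁻¹) (d j)) (tA.unique hA _) (tB.unique hB _)
    obtain ⟨e1, e2, h1, h2, h12⟩ := choose_e i j
    have a := tT.word_le hT k h1 h2
    have b := tA.word_len hA ⟨hi, hj⟩ h1 h2 h12
    have c := tB.word_len hB ⟨hi', hj'⟩ h1 h2 h12
    simp only [hs] at a
    linarith

end tri

/-- directions of a good pair -/
def dirOf {G : Type*} [Group G] (g h : G) : Fin 3 → G := ![g⁻¹, h⁻¹, g]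

/-- joining elements of a good pair -/
def joinOf {G : Type*} [Group G] (g h : G) : Fin 3 → Fin 3 → G :=
  ![![1, g * h⁻¹, g], ![h * g⁻¹, 1, h], ![g⁻¹, h⁻¹, 1]]

theorem tri_of_good {G : Type*} [Group G] {L ℓ : G → ℝ} (b : BL L ℓ) (g h : G)
    (hg : L g = ℓ g) (hh : L h = ℓ h) (hw : L (g * h⁻¹) = ℓ (g * h⁻¹))
    (hg2 : ℓ (g * g) = 2 * ℓ g) (hh2 : ℓ (h * h) = 2 * ℓ h)
    (hw2 : ℓ ((g * h⁻¹) * (g * h⁻¹)) = 2 * ℓ (g * h⁻¹))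
    (hgood : GoodPair ℓ g h) : Tri L (dirOf g h) (joinOf g h) := by
  obtain ⟨h1, h2⟩ := hgood
  have m1 := min_le_left (ℓ g) (ℓ h)
  have m2 := min_le_right (ℓ g) (ℓ h)
  have self : ∀ x, L x = ℓ x → ℓ (x * x) = 2 * ℓ x → ¬ Sim L x x⁻¹ := by
    intro x hx hx2 hs
    have := b.le (x * x)
    unfold Sim gp2 at hs
    rw [inv_inv, b.inv] at hs
    linarith
  have ssim : ∀ x, 0 < L x → Sim L x x := by
    intro x hx
    unfold Sim gp2
    rw [mul_inv_cancel, b.one]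
    linarith
  have pg : 0 < L g := by rw [hg]; linarith
  have ph : 0 < L h := by rw [hh]; linarith
  have gg := self g hg hg2
  have hhh := self h hh hh2
  have ww := self _ hw hw2
  have sgh : Sim L g h := by
    unfold Sim gp2; rw [hg, hh, hw]; exact h1
  have swh : Sim L (g * h⁻¹) h⁻¹ := by
    unfold Sim gp2
    rw [b.inv, inv_inv, inv_mul_cancel_right, hg, hh, hw]; linarith
  have swg : Sim L (g * h⁻¹)⁻¹ g⁻¹ := by
    have e : (g * h⁻¹)⁻¹ * (g⁻¹)⁻¹ = h := by group
    unfold Sim gp2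
    rw [e, b.inv, b.inv, hg, hh, hw]; linarith
  have pg' : 0 < L g⁻¹ := by rw [b.inv]; exact pg
  have ph' : 0 < L h⁻¹ := by rw [b.inv]; exact ph
  have p01 : ¬ Sim L g⁻¹ h⁻¹ := fun h3 =>
    ww (b.trans swh (b.trans (b.scomm h3) (b.scomm swg)))
  have p02 : ¬ Sim L g⁻¹ g := fun h3 => gg (b.scomm h3)
  have p12 : ¬ Sim L h⁻¹ g := fun h3 => hhh (b.trans (b.scomm sgh) (b.scomm h3))
  have d01 : Dir L (g * h⁻¹) g⁻¹ h⁻¹ := ⟨swg, swh⟩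
  have d02 : Dir L g g⁻¹ g := ⟨ssim _ pg', ssim _ pg⟩
  have d12 : Dir L h h⁻¹ g := ⟨ssim _ ph', b.scomm sgh⟩
  have d10 : Dir L (h * g⁻¹) h⁻¹ g⁻¹ := by
    have := BL.dir_inv d01
    simpa using this
  refine ⟨?_, ?_⟩
  · intro i j hij
    fin_cases i <;> fin_cases j <;> simp [dirOf] at hij ⊢
    · exact p01
    · exact p02
    · exact fun h3 => p01 (b.scomm h3)
    · exact p12
    · exact fun h3 => p02 (b.scomm h3)
    · exact fun h3 => p12 (b.scomm h3)
  · intro i j hij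
    fin_cases i <;> fin_cases j <;> simp [dirOf, joinOf] at hij ⊢
    · exact d01
    · exact d02
    · exact d10
    · exact d12
    · exact BL.dir_inv d02
    · exact BL.dir_inv d12

/-! ### Geometry of actions on real trees -/

section geom
variable {G : Type*} [Group G] {T : Type*} [MetricSpace T] {σ : T → G → T}

theorem act_dist (hσ : IsIsomRightAction σ) (p q : T) (g : G) :
    dist (σ p g) (σ q g) = dist p q := (hσ.2.2 g).dist_eq p q

theorem act_mul (hσ : IsIsomRightAction σ) (p : T) (g h : G) :
    σ p (g * h) = σ (σ p g) h := hσ.2.1 p g h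

theorem act_inv (hσ : IsIsomRightAction σ) (p : T) (g : G) :
    σ (σ p g) g⁻¹ = p := by rw [← act_mul hσ, mul_inv_cancel, hσ.1]

theorem act_inv' (hσ : IsIsomRightAction σ) (p : T) (g : G) :
    σ (σ p g⁻¹) g = p := by rw [← act_mul hσ, inv_mul_cancel, hσ.1]

theorem act_dist_inv (hσ : IsIsomRightAction σ) (p q : T) (g : G) :
    dist (σ p g⁻¹) q = dist p (σ q g) := by
  rw [← act_dist hσ (σ p g⁻¹) q g, act_inv' hσ]

theorem tl_le (σ : T → G → T) (p : T) (g : G) : transLen σ g ≤ dist p (σ p g) :=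
  ciInf_le ⟨0, by rintro _ ⟨q, rfl⟩; exact dist_nonneg⟩ p

theorem BL_of_point (hT : IsRealTree T) (hσ : IsIsomRightAction σ) (p : T) :
    BL (fun g => dist p (σ p g)) (transLen σ) := by
  obtain ⟨⟨p0⟩, -, -, h4⟩ := hT
  have key : ∀ x y : G, gp2 (fun g => dist p (σ p g)) x y =
      dist p (σ p x) + dist p (σ p y) - dist (σ p x) (σ p y) := by
    intro x y
    have : dist p (σ p (x * y⁻¹)) = dist (σ p x) (σ p y) := by
      rw [dist_comm (σ p x), act_mul hσ, ← act_dist hσ p _ y, act_inv' hσ]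
    simp only [gp2, this]
  have hinv : ∀ x : G, dist p (σ p x⁻¹) = dist p (σ p x) := by
    intro x
    rw [dist_comm, act_dist_inv hσ]
  have htri : ∀ x y : G, dist p (σ p (x * y)) ≤ dist p (σ p x) + dist p (σ p y) := by
    intro x y
    have := dist_triangle p (σ p y) (σ p (x * y))
    rw [act_mul hσ, act_dist hσ p (σ p x) y] at this
    rw [act_mul hσ]
    linarith
  refine ⟨?_, hinv, htri, ?_, ?_, ?_⟩
  · simp [hσ.1]
  · intro x y z
    rw [key, key, key]
    have := h4 (σ p x) (σ p z) p (σ p y)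
    rw [dist_comm (σ p x) p, dist_comm (σ p z) p] at this
    rcases le_max_iff.1 this with h | h
    · apply min_le_of_right_le
      rw [dist_comm (σ p y) (σ p z)]; linarith
    · apply min_le_of_left_le
      linarith
  · intro x
    exact tl_le σ p x
  · intro x hx
    rw [Sim, key, hinv, dist_comm (σ p x), act_dist_inv hσ, not_lt] at hx
    apply le_antisymm (tl_le σ p x)
    set D := dist p (σ p x) with hD
    -- powers
    have hq : ∀ n : ℕ, (n : ℝ) * D ≤ dist p (σ p (x ^ n)) ∧
        ((n : ℝ) + 1) * D ≤ dist p (σ p (x ^ (n + 1))) := by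
      intro n
      induction n with
      | zero => simp [hD]
      | succ n ih =>
        refine ⟨by push_cast; exact ih.2, ?_⟩
        by_cases hD0 : D ≤ 0
        · have : (((n + 1 : ℕ) : ℝ) + 1) * D ≤ 0 :=
            mul_nonpos_of_nonneg_of_nonpos (by positivity) hD0
          exact this.trans dist_nonneg
        push Not at hD0
        have h5 := h4 p (σ p (x * x)) (σ p x) (σ p (x ^ (n + 1 + 1)))
        have e1 : dist (σ p (x * x)) (σ p (x ^ (n + 1 + 1))) = dist p (σ p (x ^ n)) := by
          have : x ^ (n + 1 + 1) = x ^ n * (x * x) := by rw [pow_succ, pow_succ, mul_assoc]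
          rw [this, act_mul hσ _ (x ^ n), act_dist hσ]
        have e2 : dist (σ p x) (σ p (x ^ (n + 1 + 1))) = dist p (σ p (x ^ (n + 1))) := by
          rw [pow_succ x (n + 1), act_mul hσ _ (x ^ (n + 1)), act_dist hσ]
        have e3 : dist (σ p (x * x)) (σ p x) = D := by
          rw [act_mul hσ, act_dist hσ, dist_comm]
        have e4 : dist p (σ p (x ^ (n + 1))) ≤ D + dist p (σ p (x ^ n)) := by
          have := htri (x ^ n) x
          rw [← pow_succ] at this
          linarith
        rw [e1, e2, e3, act_mul hσ, ← hD] at h5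
        have h6 := ih.1
        have h7 := ih.2
        push_cast
        have e5 : ∀ k : ℕ, dist p (σ p (x ^ k)) ≤ k * D := by
          intro k
          induction k with
          | zero => simp [hσ.1]
          | succ k ihk =>
            have := htri (x ^ k) x
            rw [← pow_succ, ← hD] at this
            push_cast
            linarith
        have e6 := e5 n
        rcases le_max_iff.1 h5 with h | h
        · linarith
        · linarith
    haveI : Nonempty T := ⟨p⟩
    refine le_ciInf fun q => ?_
    by_contra hlt
    push Not at hlt
    obtain ⟨n, hn⟩ := exists_nat_gt (2 * dist p q / (D - dist q (σ q x)))
    rw [div_lt_iff₀ (by linarith)] at hn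
    have hup : ∀ n : ℕ, dist q (σ q (x ^ n)) ≤ n * dist q (σ q x) := by
      intro n
      induction n with
      | zero => simp [hσ.1]
      | succ n ih =>
        have := dist_triangle q (σ q x) (σ q (x ^ (n + 1)))
        rw [pow_succ, act_mul hσ, act_dist hσ] at this
        rw [pow_succ, act_mul hσ]
        push_cast
        linarith
    have t1 := dist_triangle p q (σ p (x ^ n))
    have t2 := dist_triangle q (σ q (x ^ n)) (σ p (x ^ n))
    rw [act_dist hσ, dist_comm q p] at t2
    have := (hq n).1
    have := hup n
    nlinarith

/-- a point on a segment -/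
theorem seg_dist (hT : IsRealTree T) (z q a b : T) (h : dist a q + dist q b = dist a b) :
    dist z q ≤ max (dist z a - dist a q) (dist z b - dist q b) := by
  have h4 := hT.2.2.2 z q a b
  rw [← h, dist_comm q a] at h4
  rcases le_max_iff.1 h4 with h | h
  · apply le_max_of_le_left; linarith
  · apply le_max_of_le_right; linarith

theorem disp_seg (hT : IsRealTree T) (hσ : IsIsomRightAction σ) (x : G) (q a b : T)
    (h : dist a q + dist q b = dist a b) :
    dist q (σ q x) ≤ max (max (dist a (σ a x) - 2 * dist a q) (dist b (σ b x) - 2 * dist q b))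
      (max (dist b (σ a x) - dist a b) (dist a (σ b x) - dist a b)) := by
  have h1 := seg_dist hT q (σ q x) (σ a x) (σ b x) (by rw [act_dist hσ, act_dist hσ, act_dist hσ, h])
  have h2 := seg_dist hT (σ a x) q a b h
  have h3 := seg_dist hT (σ b x) q a b h
  rw [act_dist hσ, act_dist hσ] at h1
  rw [dist_comm _ q, dist_comm _ a, dist_comm _ b] at h2 h3
  rcases le_max_iff.1 h1 with h1 | h1
  · rcases le_max_iff.1 h2 with h2 | h2
    · exact le_max_of_le_left (le_max_of_le_left (by linarith))
    · exact le_max_of_le_right (le_max_of_le_left (by linarith))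
  · rcases le_max_iff.1 h3 with h2 | h2
    · exact le_max_of_le_right (le_max_of_le_right (by linarith))
    · exact le_max_of_le_left (le_max_of_le_right (by linarith))

theorem convex_char (hT : IsRealTree T) (hσ : IsIsomRightAction σ) (x : G) (q a b : T)
    (h : dist a q + dist q b = dist a b) (ha : dist a (σ a x) = transLen σ x)
    (hb : dist b (σ b x) = transLen σ x) : dist q (σ q x) = transLen σ x := by
  apply le_antisymm _ (tl_le σ q x)
  refine (disp_seg hT hσ x q a b h).trans ?_
  have t1 := dist_triangle b a (σ a x)
  have t2 := dist_triangle a b (σ b x)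
  have n1 : 0 ≤ dist a q := dist_nonneg
  have n2 : 0 ≤ dist q b := dist_nonneg
  rw [dist_comm b a] at t1
  refine max_le (max_le ?_ ?_) (max_le ?_ ?_) <;> linarith

theorem seg_point (hT : IsRealTree T) (a b : T) (s : ℝ) (h0 : 0 ≤ s) (h1 : s ≤ dist a b) :
    ∃ q, dist a q = s ∧ dist q b = dist a b - s := by
  obtain ⟨f, f0, f1, hf⟩ := hT.2.2.1 a b
  refine ⟨f s, ?_, ?_⟩
  · have := hf 0 ⟨le_refl _, dist_nonneg⟩ s ⟨h0, h1⟩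
    rw [f0] at this
    rw [this, zero_sub, abs_neg, abs_of_nonneg h0]
  · have := hf s ⟨h0, h1⟩ (dist a b) ⟨dist_nonneg, le_refl _⟩
    rw [f1] at this
    rw [this, abs_sub_comm, abs_of_nonneg (by linarith)]

theorem char_nonempty (hT : IsRealTree T) (hσ : IsIsomRightAction σ) (x : G)
    (hx : 0 < transLen σ x) : ∃ y, dist y (σ y x) = transLen σ x := by
  obtain ⟨z⟩ := hT.1
  set d := dist z (σ z x) with hd
  have hd0 : 0 ≤ d := dist_nonneg
  obtain ⟨y, hy1, hy2⟩ := seg_point hT z (σ z x) (d / 2) (by linarith) (by linarith)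
  refine ⟨y, ?_⟩
  have hK := tl_le σ y x
  have h1 := disp_seg hT hσ x y z (σ z x) (by linarith)
  set K := dist y (σ y x) with hKd
  have e1 : dist (σ z x) (σ (σ z x) x) = d := by rw [act_dist hσ]
  rw [e1, dist_self, ← hd, hy1, hy2] at h1
  have hKeq : K = dist z (σ (σ z x) x) - d := by
    apply le_antisymm
    · rcases le_max_iff.1 h1 with h | h
      · rcases le_max_iff.1 h with h | h <;> linarith
      · rcases le_max_iff.1 h with h | h <;> linarith
    · have t1 := dist_triangle z y (σ (σ z x) x)
      have t2 := dist_triangle y (σ y x) (σ (σ z x) x)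
      rw [act_dist hσ] at t2
      linarith
  have b := (BL_of_point hT hσ y).eq x ?_
  · exact b.symm
  intro hs
  unfold Sim gp2 at hs
  simp only [inv_inv] at hs
  rw [dist_comm y (σ y x⁻¹), act_dist_inv hσ, act_mul hσ] at hs
  -- points y, yx, yxx, zxx
  have h4 := hT.2.2.2 y (σ (σ z x) x) (σ y x) (σ (σ y x) x)
  have f1 : dist (σ y x) (σ (σ y x) x) = K := by rw [act_dist hσ]
  have f2 : dist (σ (σ z x) x) (σ (σ y x) x) = d / 2 := by rw [act_dist hσ, act_dist hσ, hy1]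
  have f3 : dist (σ (σ z x) x) (σ y x) = d / 2 := by
    rw [act_dist hσ, dist_comm, hy2]; ring
  have f4 : d / 2 + K ≤ dist y (σ (σ z x) x) := by
    have t1 := dist_triangle z y (σ (σ z x) x)
    linarith
  rw [f1, f2, f3, ← hKd] at h4
  rcases le_max_iff.1 h4 with h | h
  · linarith
  · linarith

theorem disp_inv (hσ : IsIsomRightAction σ) (u : T) (x : G) :
    dist u (σ u x⁻¹) = dist u (σ u x) := by rw [dist_comm, act_dist_inv hσ]

theorem tl_inv (hσ : IsIsomRightAction σ) (x : G) : transLen σ x⁻¹ = transLen σ x := by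
  unfold transLen
  simp_rw [disp_inv hσ]

theorem exit_char (hT : IsRealTree T) (hσ : IsIsomRightAction σ) (x : G) (u v : T)
    (hu : dist u (σ u x) = transLen σ x)
    (hex : ∀ ε, 0 < ε → ε ≤ dist u v → ∃ q, dist u q = ε ∧ dist q v = dist u v - ε ∧
      dist q (σ q x) ≠ transLen σ x) :
    dist v (σ u x) = dist u v + transLen σ x := by
  have t0 := dist_triangle v u (σ u x)
  rw [dist_comm v u] at t0
  by_contra hne
  have hlt : dist v (σ u x) < dist u v + transLen σ x := lt_of_le_of_ne (by linarith) hne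
  have t1 := dist_triangle u (σ u x) v
  have t2 := dist_triangle (σ u x) u v
  have t3 := dist_triangle (σ u x) v u
  rw [dist_comm (σ u x) v] at t1 t3
  rw [dist_comm (σ u x) u, dist_comm v u] at t3
  obtain ⟨q, q1, q2, q3⟩ := hex ((dist u v + transLen σ x - dist v (σ u x)) / 2) (by linarith)
    (by linarith)
  apply q3
  have h1 := seg_dist hT (σ u x) q u v (by linarith)
  rw [dist_comm _ q, dist_comm _ u, dist_comm _ v] at h1
  have h2 : dist q (σ u x) ≤ transLen σ x - dist u q := by
    rcases le_max_iff.1 h1 with h | h <;> linarith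
  have t4 := dist_triangle u q (σ u x)
  refine convex_char hT hσ x q u (σ u x) (by linarith) hu ?_
  rw [act_dist hσ]; exact hu

theorem char_inter (hT : IsRealTree T) (hσ : IsIsomRightAction σ) (x y : G)
    (hx : 0 < transLen σ x) (hy : 0 < transLen σ y)
    (hxy : transLen σ (x * y) ≤ transLen σ x + transLen σ y) :
    ∃ u, dist u (σ u x) = transLen σ x ∧ dist u (σ u y) = transLen σ y := by
  obtain ⟨a, ha⟩ := char_nonempty hT hσ x hx
  obtain ⟨b, hb⟩ := char_nonempty hT hσ y hy
  obtain ⟨f, f0, f1, hf⟩ := hT.2.2.1 a b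
  have hD : 0 ≤ dist a b := dist_nonneg
  have hcont : ContinuousOn f (Set.Icc 0 (dist a b)) := by
    have : LipschitzOnWith 1 f (Set.Icc 0 (dist a b)) := by
      apply LipschitzOnWith.of_dist_le_mul
      intro s hs t ht
      rw [hf s hs t ht, Real.dist_eq]; simp
    exact this.continuousOn
  have hcomp : ∀ g : G, IsCompact (Set.Icc 0 (dist a b) ∩
      (fun s => dist (f s) (σ (f s) g)) ⁻¹' {transLen σ g}) := by
    intro g
    apply isCompact_Icc.of_isClosed_subset _ Set.inter_subset_left
    apply ContinuousOn.preimage_isClosed_of_isClosed _ isClosed_Icc isClosed_singleton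
    exact continuous_dist.comp_continuousOn (hcont.prodMk ((hσ.2.2 g).continuous.comp_continuousOn hcont))
  obtain ⟨s0, ⟨hs0, hs0x⟩, hs0m⟩ := (hcomp x).exists_isGreatest
    ⟨0, ⟨le_refl _, hD⟩, by simp [f0, ha]⟩
  obtain ⟨t0, ⟨ht0, ht0y⟩, ht0m⟩ := (hcomp y).exists_isLeast
    ⟨dist a b, ⟨hD, le_refl _⟩, by simp [f1, hb]⟩
  simp only [Set.mem_preimage, Set.mem_singleton_iff] at hs0x ht0y
  by_cases hle : t0 ≤ s0
  · refine ⟨f s0, hs0x, convex_char hT hσ y (f s0) (f t0) b ?_ ht0y hb⟩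
    have e1 := hf t0 ht0 s0 hs0
    have e2 := hf s0 hs0 (dist a b) ⟨hD, le_refl _⟩
    have e3 := hf t0 ht0 (dist a b) ⟨hD, le_refl _⟩
    rw [f1] at e2 e3
    rw [e1, e2, e3, abs_of_nonpos (by linarith), abs_of_nonpos (by linarith [hs0.2]),
      abs_of_nonpos (by linarith [ht0.2])]
    ring
  exfalso
  push Not at hle
  set u := f s0 with hu
  set v := f t0 with hv
  have huv : dist u v = t0 - s0 := by
    rw [hu, hv, hf s0 hs0 t0 ht0, abs_of_nonpos (by linarith)]; ring
  have hex : ∀ ε, 0 < ε → ε ≤ dist u v → ∃ q, dist u q = ε ∧ dist q v = dist u v - ε ∧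
      dist q (σ q x) ≠ transLen σ x := by
    intro ε h1 h2
    have hm : s0 + ε ∈ Set.Icc 0 (dist a b) := ⟨by linarith [hs0.1], by linarith [ht0.2]⟩
    refine ⟨f (s0 + ε), ?_, ?_, ?_⟩
    · rw [hu, hf s0 hs0 _ hm, abs_of_nonpos (by linarith)]; ring
    · rw [huv, hv, hf _ hm t0 ht0, abs_of_nonpos (by linarith)]; ring
    · intro hc
      have := hs0m ⟨hm, hc⟩
      linarith
  have hey : ∀ ε, 0 < ε → ε ≤ dist v u → ∃ q, dist v q = ε ∧ dist q u = dist v u - ε ∧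
      dist q (σ q y) ≠ transLen σ y := by
    intro ε h1 h2
    rw [dist_comm v u] at h2
    have hm : t0 - ε ∈ Set.Icc 0 (dist a b) := ⟨by linarith [hs0.1], by linarith [ht0.2]⟩
    refine ⟨f (t0 - ε), ?_, ?_, ?_⟩
    · rw [hv, hf t0 ht0 _ hm, abs_of_nonneg (by linarith)]; ring
    · rw [dist_comm v u, huv, hu, hf _ hm s0 hs0, abs_of_nonneg (by linarith)]; ring
    · intro hc
      have := ht0m ⟨hm, hc⟩
      linarith
  have A1 := exit_char hT hσ x u v hs0x hex
  have A2 := exit_char hT hσ x⁻¹ u v (by rw [disp_inv hσ, tl_inv hσ]; exact hs0x)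
    (by simpa only [disp_inv hσ, tl_inv hσ] using hex)
  have B1 := exit_char hT hσ y v u ht0y hey
  have B2 := exit_char hT hσ y⁻¹ v u (by rw [disp_inv hσ, tl_inv hσ]; exact ht0y)
    (by simpa only [disp_inv hσ, tl_inv hσ] using hey)
  rw [tl_inv hσ] at A2 B2
  rw [dist_comm v u] at B1 B2
  have bl := BL_of_point hT hσ u
  -- displacement of `u` under `y`
  have hdisp : ∀ z : G, dist v (σ v z) = transLen σ y → dist u (σ v z) = dist u v + transLen σ y →
      dist u (σ v z⁻¹) = dist u v + transLen σ y →
      dist v (σ u z) = dist u v + transLen σ y ∧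
      2 * dist u v + transLen σ y ≤ dist u (σ u z) := by
    intro z z1 z2 z3
    have e1 : dist v (σ u z) = dist u v + transLen σ y := by
      rw [← z3, dist_comm u, act_dist_inv hσ]
    refine ⟨e1, ?_⟩
    have h4 := hT.2.2.2 u (σ v z) v (σ u z)
    rw [act_dist hσ v u, e1, z2, dist_comm (σ v z) v, z1, dist_comm v u] at h4
    rcases le_max_iff.1 h4 with h | h <;> linarith
  have Y1 := hdisp y ht0y B1 B2
  have Y2 := hdisp y⁻¹ (by rw [disp_inv hσ]; exact ht0y) B2 (by rw [inv_inv]; exact B1)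
  -- perpendicularity
  have hperp : ∀ z w : G, dist u (σ u z) = transLen σ x → dist v (σ u z) = dist u v + transLen σ x →
      dist v (σ u w) = dist u v + transLen σ y → 2 * dist u v + transLen σ y ≤ dist u (σ u w) →
      ¬ Sim (fun g => dist u (σ u g)) z w := by
    intro z w z1 z2 w1 w2 hs
    have e : dist u (σ u (z * w⁻¹)) = dist (σ u z) (σ u w) := by
      rw [dist_comm (σ u z), act_mul hσ, ← act_dist hσ u _ w, act_inv' hσ]
    unfold Sim gp2 at hs
    simp only [e] at hs
    have h4 := hT.2.2.2 v (σ u z) u (σ u w)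
    rw [z2, w1, dist_comm v u, dist_comm (σ u z) u, z1] at h4
    rcases le_max_iff.1 h4 with h | h <;> linarith
  have P1 := hperp x y⁻¹ hs0x A1 Y2.1 Y2.2
  have P2 := hperp x⁻¹ y (by rw [disp_inv hσ]; exact hs0x) A2 Y1.1 Y1.2
  have posx : 0 < dist u (σ u x) := by rw [hs0x]; exact hx
  have posy : 0 < dist u (σ u y) := by linarith [Y1.2]
  have ssim : ∀ z, 0 < dist u (σ u z) → Sim (fun g => dist u (σ u g)) z z := by
    intro z hz
    unfold Sim gp2
    simp only [mul_inv_cancel, hσ.1, dist_self]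
    linarith
  have dx : Dir (fun g => dist u (σ u g)) x x⁻¹ x :=
    ⟨ssim _ (by rw [disp_inv hσ]; exact posx), ssim _ posx⟩
  have dy : Dir (fun g => dist u (σ u g)) y y⁻¹ y :=
    ⟨ssim _ (by rw [disp_inv hσ]; exact posy), ssim _ posy⟩
  obtain ⟨l1, d1⟩ := bl.dir_mul dx dy P1
  have l2 := bl.dir_len d1 (fun h => P2 (bl.scomm h))
  linarith [Y1.2]

theorem tri_point (hT : IsRealTree T) (hσ : IsIsomRightAction σ) (g h : G)
    (hg2 : transLen σ (g * g) = 2 * transLen σ g) (hh2 : transLen σ (h * h) = 2 * transLen σ h)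
    (hw2 : transLen σ ((g * h⁻¹) * (g * h⁻¹)) = 2 * transLen σ (g * h⁻¹))
    (hgood : GoodPair (transLen σ) g h) :
    ∃ p, Tri (fun k => dist p (σ p k)) (dirOf g h) (joinOf g h) := by
  have hgood' := hgood
  obtain ⟨h1, h2⟩ := hgood
  have m1 := min_le_left (transLen σ g) (transLen σ h)
  have m2 := min_le_right (transLen σ g) (transLen σ h)
  have n : 0 ≤ transLen σ (g * h⁻¹) := Real.iInf_nonneg fun _ => dist_nonneg
  have pg : 0 < transLen σ g := by linarith
  have ph : 0 < transLen σ h := by linarith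
  have pw : 0 < transLen σ (g * h⁻¹) := by
    rcases min_choice (transLen σ g) (transLen σ h) with h | h <;> rw [h] at h2 <;> linarith
  obtain ⟨a, a1, a2⟩ := char_inter hT hσ g h⁻¹ pg (by rw [tl_inv hσ]; exact ph)
    (by rw [tl_inv hσ]; linarith)
  rw [disp_inv hσ, tl_inv hσ] at a2
  obtain ⟨b, b1, b2⟩ := char_inter hT hσ (g * h⁻¹) h pw ph (by
    rw [inv_mul_cancel_right]; linarith)
  obtain ⟨c, c1, c2⟩ := char_inter hT hσ (g * h⁻¹)⁻¹ g (by rw [tl_inv hσ]; exact pw) pg (by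
    have : (g * h⁻¹)⁻¹ * g = h := by group
    rw [tl_inv hσ, this]; linarith)
  rw [disp_inv hσ, tl_inv hσ] at c1
  -- median of a, b, c
  have t1 := dist_triangle a b c
  have t2 := dist_triangle b a c
  have t3 := dist_triangle a c b
  rw [dist_comm b a] at t2
  rw [dist_comm c b] at t3
  obtain ⟨q, q1, q2⟩ := seg_point hT a b ((dist a b + dist a c - dist b c) / 2) (by linarith)
    (by linarith)
  have q3 := seg_dist hT c q a b (by linarith)
  rw [dist_comm c q, dist_comm c a, dist_comm c b] at q3
  have q4 : dist q c ≤ (dist a c + dist b c - dist a b) / 2 := by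
    rcases le_max_iff.1 q3 with h | h <;> linarith
  have t4 := dist_triangle a q c
  have t5 := dist_triangle b q c
  rw [dist_comm b q] at t5
  refine ⟨q, tri_of_good (BL_of_point hT hσ q) g h ?_ ?_ ?_ hg2 hh2 hw2 hgood'⟩
  · exact convex_char hT hσ g q a c (by linarith) a1 c2
  · exact convex_char hT hσ h q a b (by linarith) a2 b2
  · exact convex_char hT hσ _ q b c (by rw [dist_comm b q]; linarith) b1 c1

end geom


/-! ### Consequences of the axioms -/

namespace LF

variable {G : Type*} [Group G] {ℓ m : G → ℝ}

theorem conj (h : IsLengthFunction ℓ) {a b : G} (c : G) (hc : a = c * b * c⁻¹) : ℓ a = ℓ b := by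
  rw [hc]; exact h.2.2.2.1 b c

theorem conj_inv (h : IsLengthFunction ℓ) {a b : G} (c : G) (hc : a = c * b⁻¹ * c⁻¹) :
    ℓ a = ℓ b := by
  rw [h.2.2.1 b]; exact conj h c hc

theorem inv (h : IsLengthFunction ℓ) (x : G) : ℓ x⁻¹ = ℓ x := (h.2.2.1 x).symm

theorem five (h : IsLengthFunction ℓ) {x y : G} (hx : 0 < ℓ x) (hy : 0 < ℓ y) :
    (ℓ (x * y) = ℓ (x * y⁻¹) ∧ ℓ x + ℓ y < ℓ (x * y)) ∨
    (ℓ (x * y) = ℓ x + ℓ y ∧ ℓ (x * y⁻¹) ≤ ℓ x + ℓ y) ∨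
    (ℓ (x * y⁻¹) = ℓ x + ℓ y ∧ ℓ (x * y) ≤ ℓ x + ℓ y) := by
  rcases h.2.2.2.2.2.1 x y hx hy with h1 | h1
  · exact Or.inl h1
  · have a := le_max_left (ℓ (x * y)) (ℓ (x * y⁻¹))
    have b := le_max_right (ℓ (x * y)) (ℓ (x * y⁻¹))
    rw [h1] at a b
    rcases max_choice (ℓ (x * y)) (ℓ (x * y⁻¹)) with h2 | h2
    · exact Or.inr (Or.inl ⟨by rw [← h1, h2], b⟩)
    · exact Or.inr (Or.inr ⟨by rw [← h1, h2], a⟩)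

theorem five' (h : IsLengthFunction ℓ) {x y : G} (hx : 0 < ℓ x) (hy : 0 < ℓ y)
    (hl : ℓ (x * y⁻¹) < ℓ x + ℓ y) : ℓ (x * y) = ℓ x + ℓ y := by
  rcases five h hx hy with h1 | h1 | h1 <;> linarith [h1.1, h1.2]

theorem sq (h : IsLengthFunction ℓ) {x : G} (hx : 0 < ℓ x) : ℓ (x * x) = 2 * ℓ x := by
  rw [five' h hx hx]
  · ring
  · rw [mul_inv_cancel, h.2.1]; linarith

theorem sq_sq (h : IsLengthFunction ℓ) {x y : G} (hx : 0 < ℓ x) (hy : 0 < ℓ y)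
    (hd : |ℓ x - ℓ y| < ℓ (x * y⁻¹)) :
    ℓ ((x * x) * (y * y)⁻¹) = ℓ x + ℓ y + ℓ (x * y⁻¹) := by
  have hp : 0 < ℓ (x * y⁻¹) := lt_of_le_of_lt (abs_nonneg _) hd
  rw [abs_lt] at hd
  have h1 : ℓ (x * (x * y⁻¹)) = ℓ x + ℓ (x * y⁻¹) := by
    apply five' h hx hp
    rw [conj h (b := y) x (by group)]
    linarith
  have h2 : ℓ (x * (x * y⁻¹) * y⁻¹) = ℓ (x * (x * y⁻¹)) + ℓ y⁻¹ := by
    apply five' h (by linarith) (by rw [inv h]; exact hy)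
    have : x * (x * y⁻¹) * y⁻¹⁻¹ = x * x := by group
    rw [this, sq h hx, h1, inv h]
    linarith
  have e : (x * x) * (y * y)⁻¹ = x * (x * y⁻¹) * y⁻¹ := by group
  rw [e, h2, h1, inv h]
  ring

/-- The axes of `x` and `y` have an overlap shorter than both translation lengths. -/
def PP (ℓ : G → ℝ) (x y : G) : Prop :=
  0 < ℓ x ∧ 0 < ℓ y ∧ |ℓ x - ℓ y| < ℓ (x * y) ∧ |ℓ x - ℓ y| < ℓ (x * y⁻¹)

theorem PP.inv (h : IsLengthFunction ℓ) {x y : G} (hp : PP ℓ x y) : PP ℓ x y⁻¹ := by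
  unfold PP at *
  rw [LF.inv h, inv_inv]
  tauto

theorem PP.symm (h : IsLengthFunction ℓ) {x y : G} (hp : PP ℓ x y) : PP ℓ y x := by
  unfold PP at *
  rw [abs_sub_comm, conj h (a := y * x) (b := x * y) y (by group),
    conj_inv h (a := y * x⁻¹) (b := x * y⁻¹) 1 (by group)]
  tauto

theorem PP.sum (h : IsLengthFunction ℓ) {x y : G} (hp : PP ℓ x y) :
    2 * ℓ x < ℓ (x * y) + ℓ (x * y⁻¹) ∧ 2 * ℓ y < ℓ (x * y) + ℓ (x * y⁻¹) := by
  obtain ⟨h1, h2, h3, h4⟩ := hp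
  rw [abs_lt] at h3 h4
  rcases five h h1 h2 with h5 | h5 | h5 <;> constructor <;> linarith [h5.1, h5.2]

theorem PP.disj (h : IsLengthFunction ℓ) {x y : G} (hp : PP ℓ x y) :
    (x, y⁻¹ * x * y) ∈ DisjointSet ℓ := by
  obtain ⟨s1, s2⟩ := hp.sum h
  obtain ⟨h1, h2, h3, h4⟩ := hp
  have p3 := lt_of_le_of_lt (abs_nonneg _) h3
  have p4 := lt_of_le_of_lt (abs_nonneg _) h4
  have e0 : ℓ (y⁻¹ * x * y) = ℓ x := conj h y⁻¹ (by group)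
  have e1 : ℓ ((x * y⁻¹) * (x * y)) = ℓ (x * y⁻¹) + ℓ (x * y) := by
    apply five' h p4 p3
    rw [conj_inv h (b := y * y) x (by group), sq h h2]
    linarith
  have e2 : ℓ (x * (y⁻¹ * x * y)) = ℓ (x * y⁻¹) + ℓ (x * y) := by
    rw [← e1]; congr 1; group
  have e3 : ℓ (x * (y⁻¹ * x * y)) = ℓ (x * (y⁻¹ * x * y)⁻¹) ∧
      ℓ x + ℓ (y⁻¹ * x * y) < ℓ (x * (y⁻¹ * x * y)) := by
    rcases five h h1 (y := y⁻¹ * x * y) (by rw [e0]; exact h1) with h5 | h5 | h5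
    · exact h5
    · linarith [h5.1]
    · linarith [h5.2]
  refine ⟨?_, e3.1, e3.2⟩
  intro heq
  have e4 := e3.1
  dsimp only at heq
  have : x * (y⁻¹ * x * y)⁻¹ = 1 := by rw [← heq, mul_inv_cancel]
  rw [this, h.2.1] at e4
  linarith

theorem comm_ge (hm : IsLengthFunction m) (h : IsLengthFunction ℓ)
    (hcc : CompatibleCombinatorics ℓ m) {x y : G} (hp : PP ℓ x y) (hx : 0 < m x) :
    2 * m x ≤ m (x * (y⁻¹ * x * y)⁻¹) := by
  have hd := hp.disj h
  have e0 : m (y⁻¹ * x * y) = m x := conj hm y⁻¹ (by group)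
  have e1 : m (x * (y⁻¹ * x * y)) = m (x * (y⁻¹ * x * y)⁻¹) := by
    by_contra hne
    have : (x, y⁻¹ * x * y) ∈ DisjointSet ℓ ∩ OverlapSet m := ⟨hd, hd.1, hne⟩
    rw [hcc.2] at this
    exact this
  rcases five hm hx (y := y⁻¹ * x * y) (by rw [e0]; exact hx) with h5 | h5 | h5 <;>
    linarith [h5.1, h5.2]

theorem transfer_half (hm : IsLengthFunction m) (h : IsLengthFunction ℓ)
    (hcc : CompatibleCombinatorics ℓ m) {x y : G} (hp : PP ℓ x y) (hx : 0 < m x) (hy : 0 < m y) :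
    |m (x * x) - m (y * y)| < m ((x * x) * (y * y)⁻¹) := by
  have c1 := comm_ge hm h hcc hp hx
  have c2 := comm_ge hm h hcc (hp.symm h) hy
  have e1 : m (x * (y⁻¹ * x * y)⁻¹) = m ((x * y⁻¹) * (x⁻¹ * y)) := by congr 1; group
  have e2 : m (y * (x⁻¹ * y * x)⁻¹) = m ((x * y⁻¹) * (x⁻¹ * y)) :=
    conj_inv hm (x⁻¹ * y) (by group)
  have e3 : m ((x * y⁻¹) * (x⁻¹ * y)⁻¹) = m ((x * x) * (y * y)⁻¹) := conj hm x⁻¹ (by group)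
  have e4 : m (x⁻¹ * y) = m (x * y⁻¹) := conj_inv hm x⁻¹ (by group)
  rw [e1] at c1
  rw [e2] at c2
  rw [sq hm hx, sq hm hy]
  rcases hm.2.2.2.2.1 (x * y⁻¹) (x⁻¹ * y) with h5 | h5
  · rw [← e3, ← h5, abs_lt]; constructor <;> linarith
  · have h6 := (le_max_left _ _).trans h5
    rw [e4] at h6
    rw [sq_sq hm hx hy (by rw [abs_lt]; constructor <;> linarith), abs_lt]
    constructor <;> linarith

theorem transfer (hm : IsLengthFunction m) (h : IsLengthFunction ℓ)
    (hcc : CompatibleCombinatorics ℓ m) {x y : G} (hp : PP ℓ x y) (hx : 0 < m x) (hy : 0 < m y) :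
    PP m (x * x) (y * y) := by
  refine ⟨by rw [sq hm hx]; linarith, by rw [sq hm hy]; linarith, ?_,
    transfer_half hm h hcc hp hx hy⟩
  have := transfer_half hm h hcc (hp.inv h) hx (by rw [inv hm]; exact hy)
  have e1 : y⁻¹ * y⁻¹ = (y * y)⁻¹ := by group
  rwa [e1, inv_inv, inv hm] at this

theorem PP.sqr (h : IsLengthFunction ℓ) {x y : G} (hp : PP ℓ x y) : PP ℓ (x * x) (y * y) := by
  have hp' := hp.inv h
  obtain ⟨h1, h2, h3, h4⟩ := hp
  obtain ⟨h1', h2', h3', h4'⟩ := hp'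
  refine ⟨by rw [sq h h1]; linarith, by rw [sq h h2]; linarith, ?_, ?_⟩
  · have := sq_sq h h1' h2' h4'
    have e1 : (y⁻¹ * y⁻¹)⁻¹ = y * y := by simp
    rw [e1, inv_inv, LF.inv h] at this
    rw [this, sq h h1, sq h h2]
    rw [abs_lt] at *
    constructor <;> linarith
  · rw [sq_sq h h1 h2 h4, sq h h1, sq h h2]
    rw [abs_lt] at *
    constructor <;> linarith

/-- good pair with all three elements hyperbolic -/
def GP (ℓ : G → ℝ) (g h : G) : Prop :=
  GoodPair ℓ g h ∧ 0 < ℓ g ∧ 0 < ℓ h ∧ 0 < ℓ (g * h⁻¹)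

theorem PP.good (h : IsLengthFunction ℓ) {x y : G} (hp : PP ℓ x y)
    (hs : ℓ (x * y⁻¹) ≤ ℓ (x * y)) : GP ℓ (x * x) (x * y) := by
  obtain ⟨s1, s2⟩ := hp.sum h
  obtain ⟨h1, h2, h3, h4⟩ := hp
  have p3 := lt_of_le_of_lt (abs_nonneg _) h3
  have p4 := lt_of_le_of_lt (abs_nonneg _) h4
  have e : ℓ ((x * x) * (x * y)⁻¹) = ℓ (x * y⁻¹) := conj h x (by group)
  unfold GP GoodPair
  rw [e, sq h h1]
  rw [abs_lt] at h3 h4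
  refine ⟨⟨by linarith, ?_⟩, by linarith, p3, p4⟩
  rcases five h h1 h2 with h5 | h5 | h5 <;>
  rcases min_choice (2 * ℓ x) (ℓ (x * y)) with h6 | h6 <;> rw [h6] <;> linarith [h5.1, h5.2]

theorem common_good (h : IsLengthFunction ℓ) (hm : IsLengthFunction m)
    (hco : CoherentlyOriented ℓ m) {x y : G} (hp : PP ℓ x y) (hq : PP m x y) :
    ∃ a b, GP ℓ a b ∧ GP m a b := by
  by_cases hs : ℓ (x * y⁻¹) ≤ ℓ (x * y) ∧ m (x * y⁻¹) ≤ m (x * y)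
  · exact ⟨_, _, hp.good h hs.1, hq.good hm hs.2⟩
  · have key : ℓ (x * y) ≤ ℓ (x * y⁻¹) ∧ m (x * y) ≤ m (x * y⁻¹) := by
      by_contra hs2
      have hne : x ≠ y := by
        rintro rfl
        have := lt_of_le_of_lt (abs_nonneg _) hp.2.2.2
        rw [mul_inv_cancel, h.2.1] at this
        exact lt_irrefl _ this
      have hne1 : ℓ (x * y) ≠ ℓ (x * y⁻¹) := by
        intro he
        rw [he] at hs hs2
        have := le_total (m (x * y)) (m (x * y⁻¹))
        simp only [le_refl, true_and] at hs hs2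
        tauto
      have hne2 : m (x * y) ≠ m (x * y⁻¹) := by
        intro he
        rw [he] at hs hs2
        have := le_total (ℓ (x * y)) (ℓ (x * y⁻¹))
        simp only [le_refl, and_true] at hs hs2
        tauto
      have := hco (x, y) ⟨⟨hne, hne1⟩, ⟨hne, hne2⟩⟩
      dsimp only at this
      rcases lt_or_gt_of_ne hne1 with h1 | h1
      · rcases lt_or_gt_of_ne hne2 with h2 | h2
        · exact hs2 ⟨h1.le, h2.le⟩
        · exact lt_asymm h1 (this.2 h2)
      · exact hs ⟨h1.le, (this.1 h1).le⟩
    exact ⟨_, _, (hp.inv h).good h (by rw [inv_inv]; exact key.1),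
      (hq.inv hm).good hm (by rw [inv_inv]; exact key.2)⟩

theorem GP_of_six (h : IsLengthFunction ℓ) : ∃ a b, GP ℓ a b := by
  obtain ⟨a, b, h1, h2⟩ := h.2.2.2.2.2.2
  have m1 := min_le_left (ℓ a) (ℓ b)
  have m2 := min_le_right (ℓ a) (ℓ b)
  have n := h.1 (a * b⁻¹)
  refine ⟨a, b, ⟨h1, h2⟩, by linarith, by linarith, ?_⟩
  rcases min_choice (ℓ a) (ℓ b) with h | h <;> rw [h] at h2 <;> linarith

theorem exists_third (i j : Fin 3) : ∃ k : Fin 3, k ≠ i ∧ k ≠ j := by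
  revert i j; decide

theorem exists_PP {L : G → ℝ} {d : Fin 3 → G} {E : Fin 3 → Fin 3 → G}
    (h : IsLengthFunction ℓ) (hm : IsLengthFunction m) (b : BL L ℓ) (t : Tri L d E) :
    ∃ x y, PP ℓ x y ∧ 0 < m x ∧ 0 < m y := by
  obtain ⟨c, -, -, hc, -⟩ := GP_of_six hm
  obtain ⟨i, hi, -⟩ := pigeon3 (fun i => Sim L c (d i)) (fun i => Sim L c (d i))
    (t.unique b c) (t.unique b c)
  obtain ⟨j, hj, hji⟩ := pigeon3 (fun j => Sim L (d i * c⁻¹) (d j)) (fun j => j = i)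
    (t.unique b _) (fun _ _ h1 h2 => h1.trans h2.symm)
  obtain ⟨e1, e2, h1, h2, h12⟩ := choose_e i j
  have w1 := b.dir_mul (t.dir e1 j h1) (t.dir i e2 h2.symm) (t.perp _ _ hji)
  have w2 := t.word b ⟨hi, hj⟩ h1 h2 h12
  have w3 := b.dir_mul w1.2 w2.2 (t.perp _ _ h12.symm)
  have hg : ∃ g, 0 < m g ∧ Dir L g (d e1) (d e2) := by
    by_contra hcon
    push Not at hcon
    have z : ∀ g, Dir L g (d e1) (d e2) → m g = 0 := fun g hg =>
      le_antisymm (not_lt.1 fun h3 => hcon g h3 hg) (hm.1 g)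
    have z1 := z _ w1.2
    have z2 := z _ w2.2
    have z3 := z _ w3.2
    generalize E e1 j = u at *
    generalize E i e2 = v at *
    have f1 : m (v * u) = 0 := by rw [← z1]; exact conj hm v (by group)
    have f2 : m (v * u * c) = 0 := by rw [← z2]; exact conj hm v (by group)
    have f3 : m ((v * u) * (v * u * c)) = 0 := by rw [← z3]; exact conj hm v (by group)
    have f4 : m ((v * u) * (v * u * c)⁻¹) = m c := conj_inv hm (v * u) (by group)
    rcases hm.2.2.2.2.1 (v * u) (v * u * c) with h5 | h5
    · linarith
    · have := (le_max_right _ _).trans h5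
      linarith
  obtain ⟨g, mg, dg⟩ := hg
  obtain ⟨e3, h31, h32⟩ := exists_third e1 e2
  have lg : ℓ g = L g := b.dir_len dg (t.perp _ _ h12.symm)
  have pg : 0 < ℓ g := by
    have := b.pos dg.2
    rwa [lg]
  have k1 := b.dir_mul (t.dir e3 e1 h31) (t.dir e2 e3 h32.symm) (t.perp _ _ h12)
  generalize E e3 e1 * E e2 e3 = k at *
  have dk := k1.2
  have pk := b.pos dk.2
  have v1 := b.dir_mul dg dk (t.perp _ _ h32.symm)
  have v2 := b.dir_mul (BL.dir_inv dk) v1.2 (t.perp _ _ h31)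
  have v3 := b.dir_mul dg v2.2 (t.perp _ _ h32.symm)
  have lw := b.dir_len v3.2 (t.perp _ _ h31)
  have lw2 : ℓ (g * (k⁻¹ * (g * k))) = 2 * ℓ g + 2 * L k := by
    rw [lw, v3.1, v2.1, v1.1, lg, b.inv]; ring
  have eh : ℓ (k⁻¹ * (g * k)) = ℓ g := conj h k⁻¹ (by group)
  have mh : m (k⁻¹ * (g * k)) = m g := conj hm k⁻¹ (by group)
  refine ⟨g, k⁻¹ * (g * k), ⟨pg, by rw [eh]; exact pg, ?_, ?_⟩, mg, by rw [mh]; exact mg⟩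
  · rw [eh, sub_self, abs_zero]; linarith
  · rw [eh, sub_self, abs_zero]
    rcases five h pg (y := k⁻¹ * (g * k)) (by rw [eh]; exact pg) with h5 | h5 | h5 <;>
      linarith [h5.1, h5.2]

theorem GP.sum {n : G → ℝ} {g h : G} (hn : ∀ g, n g = ℓ g + m g) (h1 : GP ℓ g h)
    (h2 : GP m g h) : GoodPair n g h := by
  obtain ⟨⟨a1, a2⟩, -⟩ := h1
  obtain ⟨⟨b1, b2⟩, -⟩ := h2
  unfold GoodPair
  simp only [hn]
  refine ⟨by linarith, ?_⟩
  have c1 := min_le_left (ℓ g) (ℓ h)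
  have c2 := min_le_right (ℓ g) (ℓ h)
  have c3 := min_le_left (m g) (m h)
  have c4 := min_le_right (m g) (m h)
  rcases min_choice (ℓ g + m g) (ℓ h + m h) with h6 | h6 <;> rw [h6] <;> linarith

end LF

/-- if `A`, `B` are minimal `G`-trees whose length functions `ℓ`,
`m` are compatible axiomatic length functions and `T` is a minimal `G`-tree with
`ℓ_T = ℓ + m`, then there are basepoints `p ∈ A`, `q ∈ B`, `r ∈ T` with
`d(r, r·g) = d(p, p·g) + d(q, q·g)` for all `g`. -/
theorem based_length_function_sum {G : Type*} [Group G]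
    {A : Type*} [MetricSpace A] {B : Type*} [MetricSpace B]
    {T : Type*} [MetricSpace T]
    (σA : A → G → A) (σB : B → G → B) (σT : T → G → T)
    (hA : IsRealTree A) (hB : IsRealTree B) (hT : IsRealTree T)
    (hσA : IsIsomRightAction σA) (hσB : IsIsomRightAction σB)
    (hσT : IsIsomRightAction σT)
    (hminA : IsMinimalAction σA) (hminB : IsMinimalAction σB)
    (hminT : IsMinimalAction σT)
    (hℓ : IsLengthFunction (transLen σA)) (hm : IsLengthFunction (transLen σB))
    (hcc : CompatibleCombinatorics (transLen σA) (transLen σB))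
    (hco : CoherentlyOriented (transLen σA) (transLen σB))
    (hsum : ∀ g : G, transLen σT g = transLen σA g + transLen σB g) :
    ∃ (p : A) (q : B) (r : T), ∀ g : G,
      dist r (σT r g) = dist p (σA p g) + dist q (σB q g) := by
  obtain ⟨a, b, hab, pa, pb, pab⟩ := LF.GP_of_six hℓ
  obtain ⟨p0, t0⟩ := tri_point hA hσA a b (LF.sq hℓ pa) (LF.sq hℓ pb) (LF.sq hℓ pab) hab
  obtain ⟨x, y, hxy, mx, my⟩ := LF.exists_PP hℓ hm (BL_of_point hA hσA p0) t0
  obtain ⟨g, h, gA, gB⟩ := LF.common_good hℓ hm hco (hxy.sqr hℓ)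
    (LF.transfer hm hℓ hcc hxy mx my)
  have gT := LF.GP.sum hsum gA gB
  obtain ⟨goodA, a1, a2, a3⟩ := gA
  obtain ⟨goodB, b1, b2, b3⟩ := gB
  obtain ⟨p, tp⟩ := tri_point hA hσA g h (LF.sq hℓ a1) (LF.sq hℓ a2) (LF.sq hℓ a3) goodA
  obtain ⟨q, tq⟩ := tri_point hB hσB g h (LF.sq hm b1) (LF.sq hm b2) (LF.sq hm b3) goodB
  obtain ⟨r, tr⟩ := tri_point hT hσT g h
    (by rw [hsum, hsum, LF.sq hℓ a1, LF.sq hm b1]; ring)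
    (by rw [hsum, hsum, LF.sq hℓ a2, LF.sq hm b2]; ring)
    (by rw [hsum, hsum, LF.sq hℓ a3, LF.sq hm b3]; ring) gT
  exact ⟨p, q, r, based_sum (BL_of_point hA hσA p) (BL_of_point hB hσB q)
    (BL_of_point hT hσT r) tp tq tr hsum⟩
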